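/- arXiv:math/0311445 — 9 statements merged into one kernel-verified Lean document; each statement's English description precedes it below -/
import Mathlib

section
/- Let d be an integer and m : Fin 4 → ℤ, and set k = 2d - (m 0 + m 1 + m 2 + m 3). Then the map a ↦ (i ↦ d - a i - m i) is a bijection from T(d,m) onto T(d+k, i ↦ m i + k), and applying the corresponding map for the parameters (d+k, i ↦ m i + k) to the image returns the original element (i.e. the map is an involution between the two sets). -/
/-- The exponent set `T(d,m)` of monomials of degree `d` in four variables with
multiplicity at least `m i` at the `i`-th coordinate point of `ℙ³`. -/
def cremonaT (d : ℤ) (m : Fin 4 → ℤ) : Set (Fin 4 → ℤ) :=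
  {a | (∀ i, 0 ≤ a i ∧ a i ≤ d - m i) ∧ ∑ i, a i = d}

/-- The map induced by the cubo-cubic Cremona transformation on exponent vectors. -/
def cremonaMap (d : ℤ) (m : Fin 4 → ℤ) : (Fin 4 → ℤ) → (Fin 4 → ℤ) :=
  fun a i => d - a i - m i

theorem cremona_bijection (d : ℤ) (m : Fin 4 → ℤ) (k : ℤ)
    (hk : k = 2 * d - (m 0 + m 1 + m 2 + m 3)) :
    Set.BijOn (cremonaMap d m) (cremonaT d m) (cremonaT (d + k) (fun i => m i + k)) ∧
    ∀ a ∈ cremonaT d m,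
      cremonaMap (d + k) (fun i => m i + k) (cremonaMap d m a) = a := by
  refine ⟨⟨?_, ?_, ?_⟩, ?_⟩
  · rintro a ⟨h, hs⟩
    refine ⟨fun i => ?_, ?_⟩
    · have := h i
      simp only [cremonaMap]
      constructor <;> linarith
    · simp only [cremonaMap, Fin.sum_univ_four] at hs ⊢
      linarith
  · intro a _ b _ hab
    funext i
    have := congrFun hab i
    simp only [cremonaMap] at this
    linarith
  · rintro b ⟨h, hs⟩
    refine ⟨fun i => d - b i - m i, ⟨fun i => ?_, ?_⟩, ?_⟩
    · have := h i
      simp only at this ⊢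
      constructor <;> linarith
    · simp only [Fin.sum_univ_four] at hs ⊢
      linarith
    · funext i
      simp only [cremonaMap]
      ring
  · intro a _
    funext i
    simp only [cremonaMap]
    ring
end

section
/- Let K be a field, d a natural number, m : Fin 4 → ℕ, and set k = 2d - (m 0 + m 1 + m 2 + m 3) ∈ ℤ. Suppose d' and m' : Fin 4 → ℕ are natural numbers with (d' : ℤ) = d + k and (m' i : ℤ) = m i + k for each i. Then the K-vector space of homogeneous polynomials of degree d in K[x₀,x₁,x₂,x₃] vanishing to order ≥ m i at the i-th coordinate point for every i has the same dimension as the K-vector space of homogeneous polynomials of degree d' vanishing to order ≥ m' i at the i-th coordinate point for every i. -/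
open MvPolynomial

/-- The linear system `L₃(d, m₀, …, m₃)`: the space of homogeneous polynomials of
degree `d` in `K[x₀,x₁,x₂,x₃]` vanishing to order `≥ m i` at the `i`-th coordinate
point for every `i`, i.e. such that every monomial `x^a` in the support satisfies
`∑_{j ≠ i} a j ≥ m i`. -/
def linSys (K : Type*) [Field K] (d : ℕ) (m : Fin 4 → ℕ) :
    Submodule K (MvPolynomial (Fin 4) K) where
  carrier := {P | P.IsHomogeneous d ∧
    ∀ i, ∀ a ∈ P.support, m i ≤ ∑ j ∈ Finset.univ.erase i, a j}
  zero_mem' := ⟨(homogeneousSubmodule (Fin 4) K d).zero_mem, by simp⟩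
  add_mem' := by
    rintro P Q ⟨hP, hP'⟩ ⟨hQ, hQ'⟩
    refine ⟨(homogeneousSubmodule (Fin 4) K d).add_mem hP hQ, fun i a ha => ?_⟩
    rcases Finset.mem_union.mp (MvPolynomial.support_add ha) with h | h
    · exact hP' i a h
    · exact hQ' i a h
  smul_mem' := by
    rintro c P ⟨hP, hP'⟩
    exact ⟨(homogeneousSubmodule (Fin 4) K d).smul_mem c hP,
      fun i a ha => hP' i a (MvPolynomial.support_smul ha)⟩

/-- Exponents of the monomials in the linear system. -/
def expSet (d : ℕ) (m : Fin 4 → ℕ) : Set (Fin 4 →₀ ℕ) :=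
  {a | a 0 + a 1 + a 2 + a 3 = d ∧ ∀ i, a i + m i ≤ d}

lemma linSys_eq (K : Type*) [Field K] (d : ℕ) (m : Fin 4 → ℕ) :
    linSys K d m = restrictSupport K (expSet d m) := by
  ext P
  have key : ∀ a : Fin 4 →₀ ℕ, a ∈ expSet d m ↔
      (a.degree = d ∧ ∀ i, m i ≤ ∑ j ∈ Finset.univ.erase i, a j) := by
    intro a
    have h1 : a.degree = a 0 + a 1 + a 2 + a 3 := by
      rw [Finsupp.degree_eq_sum, Fin.sum_univ_four]
    rw [h1]
    refine and_congr_right fun h => forall_congr' fun i => ?_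
    have h2 := Finset.add_sum_erase Finset.univ (fun j => a j) (Finset.mem_univ i)
    rw [Fin.sum_univ_four] at h2
    omega
  have hw : ∀ a : Fin 4 →₀ ℕ, Finsupp.weight (1 : Fin 4 → ℕ) a = a.degree := fun a =>
    (DFunLike.congr_fun (Finsupp.degree_eq_weight_one (R := ℕ)) a).symm
  rw [mem_restrictSupport_iff]
  constructor
  · rintro ⟨h1, h2⟩ a ha
    refine (key a).2 ⟨?_, fun i => h2 i a ha⟩
    have := h1 (mem_support_iff.1 ha)
    exact (hw a).symm.trans this
  · intro h
    refine ⟨fun a ha => ?_, fun i a ha => ((key a).1 (h ha)).2 i⟩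
    exact (hw a).trans ((key a).1 (h (Finset.mem_coe.2 (mem_support_iff.2 ha)))).1

/-- The map on exponents induced by the Cremona transformation. -/
noncomputable def crem (d : ℕ) (m : Fin 4 → ℕ) (a : Fin 4 →₀ ℕ) : Fin 4 →₀ ℕ :=
  Finsupp.equivFunOnFinite.symm fun i => d - m i - a i

lemma crem_apply (d : ℕ) (m : Fin 4 → ℕ) (a : Fin 4 →₀ ℕ) (i : Fin 4) :
    crem d m a i = d - m i - a i := rfl

lemma crem_mem (d : ℕ) (m : Fin 4 → ℕ) (d' : ℕ) (m' : Fin 4 → ℕ)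
    (h : (d' : ℤ) = 3 * (d : ℤ) - (m 0 + m 1 + m 2 + m 3))
    (h' : ∀ i, (m' i : ℤ) - d' = (m i : ℤ) - d) (a : Fin 4 →₀ ℕ)
    (ha : a ∈ expSet d m) : crem d m a ∈ expSet d' m' := by
  obtain ⟨h1, h2⟩ := ha
  refine ⟨?_, fun i => ?_⟩
  · simp only [crem_apply]
    have := h2 0
    have := h2 1
    have := h2 2
    have := h2 3
    omega
  · rw [crem_apply]
    have := h2 i
    have := h' i
    omega

lemma crem_crem (d : ℕ) (m : Fin 4 → ℕ) (d' : ℕ) (m' : Fin 4 → ℕ)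
    (h' : ∀ i, (m' i : ℤ) - d' = (m i : ℤ) - d) (a : Fin 4 →₀ ℕ)
    (ha : a ∈ expSet d m) : crem d' m' (crem d m a) = a := by
  ext i
  rw [crem_apply, crem_apply]
  have := ha.2 i
  have := h' i
  omega

theorem cremona_dim_invariance (K : Type*) [Field K] (d : ℕ) (m : Fin 4 → ℕ)
    (k : ℤ) (hk : k = 2 * (d : ℤ) - (m 0 + m 1 + m 2 + m 3))
    (d' : ℕ) (m' : Fin 4 → ℕ)
    (hd' : (d' : ℤ) = (d : ℤ) + k) (hm' : ∀ i, (m' i : ℤ) = (m i : ℤ) + k) :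
    Module.rank K (linSys K d m) = Module.rank K (linSys K d' m') := by
  have h1 : (d' : ℤ) = 3 * (d : ℤ) - (m 0 + m 1 + m 2 + m 3) := by omega
  have h2 : ∀ i, (m' i : ℤ) - d' = (m i : ℤ) - d := fun i => by
    have := hm' i
    omega
  have h3 : (d : ℤ) = 3 * (d' : ℤ) - (m' 0 + m' 1 + m' 2 + m' 3) := by
    have := hm' 0
    have := hm' 1
    have := hm' 2
    have := hm' 3
    omega
  have h4 : ∀ i, (m i : ℤ) - d = (m' i : ℤ) - d' := fun i => (h2 i).symm
  let e : expSet d m ≃ expSet d' m' :=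
    { toFun := fun a => ⟨crem d m a, crem_mem d m d' m' h1 h2 a a.2⟩
      invFun := fun a => ⟨crem d' m' a, crem_mem d' m' d m h3 h4 a a.2⟩
      left_inv := fun a => Subtype.ext (crem_crem d m d' m' h2 a a.2)
      right_inv := fun a => Subtype.ext (crem_crem d' m' d m h4 a a.2) }
  rw [linSys_eq, linSys_eq]
  exact ((basisRestrictSupport K (expSet d m)).equiv
    (basisRestrictSupport K (expSet d' m')) e).rank_eq
end

section
/- Let d be a natural number and m : Fin 4 → ℕ with m i ≤ d for all i, and suppose 2d ≥ m i + m j + m k for every three distinct indices i, j, k in Fin 4. Then the cardinality of the set T = { a : Fin 4 → ℕ | Σ_i a i = d and a i ≤ d - m i for all i } satisfies, as an identity in ℤ: #T = C(d+3, 3) - Σ_i C(m i + 2, 3) + Σ_{i<j} c_{ij}, where c_{ij} = C(m i + m j - d + 1, 3) if m i + m j ≥ d + 2 and c_{ij} = 0 otherwise. -/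
lemma aux_card (d : ℕ) (v : Fin 4 → ℕ) :
    (((Finset.piAntidiag Finset.univ d).filter (fun a : Fin 4 → ℕ => ∀ i, v i ≤ a i)).card : ℤ)
      = if ∑ i, v i ≤ d then ((d - ∑ i, v i + 3).choose 3 : ℤ) else 0 := by
  split_ifs with h
  · have e : (Finset.piAntidiag Finset.univ d).filter (fun a : Fin 4 → ℕ => ∀ i, v i ≤ a i)
        = (Finset.piAntidiag Finset.univ (d - ∑ i, v i)).map (addRightEmbedding v) := by
      ext a
      simp only [Finset.mem_filter, Finset.mem_piAntidiag, Finset.mem_map, addRightEmbedding_apply]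
      constructor
      · rintro ⟨⟨h1, -⟩, h2⟩
        refine ⟨fun i => a i - v i, ⟨?_, by simp⟩, ?_⟩
        · have := h2 0; have := h2 1; have := h2 2; have := h2 3
          simp only [Fin.sum_univ_four] at *
          omega
        · funext i
          simp [h2 i]
      · rintro ⟨b, ⟨h1, -⟩, rfl⟩
        refine ⟨⟨?_, by simp⟩, by simp⟩
        simp only [Fin.sum_univ_four, Pi.add_apply] at *
        omega
    rw [e, Finset.card_map, ← Finset.card_attach]
    have := Finset.card_finsuppAntidiag_nat_eq_choose (s := (Finset.univ : Finset (Fin 4))) (d - ∑ i, v i)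
    rw [Finset.finsuppAntidiag, Finset.card_map] at this
    rw [this, Finset.card_univ, Fintype.card_fin,
      show 4 + (d - ∑ i, v i) - 1 = (d - ∑ i, v i) + 3 by omega, Nat.choose_symm_add]
  · simp only [Nat.cast_eq_zero, Finset.card_eq_zero, Finset.filter_eq_empty_iff,
      Finset.mem_piAntidiag]
    rintro a ⟨h1, -⟩ h2
    exact h (h1 ▸ Finset.sum_le_sum (fun i _ => h2 i))

lemma aux_single (d n : ℕ) (hn : n ≤ d) (i : Fin 4) :
    (∑ a ∈ Finset.piAntidiag (Finset.univ : Finset (Fin 4)) d, if d - n < a i then (1:ℤ) else 0)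
      = ((n + 2).choose 3 : ℤ) := by
  have h := aux_card d (Pi.single i (d - n + 1))
  rw [Finset.sum_boole]
  have e : ∀ a : Fin 4 → ℕ,
      (∀ k, (Pi.single i (d - n + 1) : Fin 4 → ℕ) k ≤ a k) ↔ d - n < a i := by
    intro a
    constructor
    · intro h; have := h i; simp at this; omega
    · intro h k
      by_cases hk : k = i
      · subst hk; simp; omega
      · simp [hk]
  simp only [e] at h
  rw [h, Finset.sum_pi_single']
  simp only [Finset.mem_univ, if_true]
  split_ifs with h1
  · congr 2; omega
  · have : n = 0 := by omega
    subst this; rfl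

lemma aux_pair (d n p : ℕ) (hn : n ≤ d) (hp : p ≤ d) (i j : Fin 4) (hij : i ≠ j) :
    (∑ a ∈ Finset.piAntidiag (Finset.univ : Finset (Fin 4)) d,
      if d - n < a i ∧ d - p < a j then (1:ℤ) else 0)
      = if d + 2 ≤ n + p then ((n + p - d + 1).choose 3 : ℤ) else 0 := by
  have h := aux_card d (Pi.single i (d - n + 1) + Pi.single j (d - p + 1))
  rw [Finset.sum_boole]
  have e : ∀ a : Fin 4 → ℕ,
      (∀ k, (Pi.single i (d - n + 1) + Pi.single j (d - p + 1) : Fin 4 → ℕ) k ≤ a k) ↔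
        (d - n < a i ∧ d - p < a j) := by
    intro a
    constructor
    · intro h
      have h1 := h i
      have h2 := h j
      simp [hij, hij.symm] at h1 h2
      omega
    · rintro ⟨h1, h2⟩ k
      by_cases hk : k = i
      · subst hk; simp [hij]; omega
      · by_cases hk' : k = j
        · subst hk'; simp [hk]; omega
        · simp [hk, hk']
  simp only [e] at h
  rw [h]
  simp only [Pi.add_apply, Finset.sum_add_distrib, Finset.sum_pi_single', Finset.mem_univ, if_true]
  split_ifs with h1 h2 h2
  · congr 2; omega
  · omega
  · omega
  · rfl

theorem dim_formula (d : ℕ) (m : Fin 4 → ℕ) (hm : ∀ i, m i ≤ d)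
    (hstd : ∀ i j k : Fin 4, i ≠ j → i ≠ k → j ≠ k → m i + m j + m k ≤ 2 * d) :
    let T : Set (Fin 4 → ℕ) := {a | ∑ i, a i = d ∧ ∀ i, a i ≤ d - m i}
    let c : Fin 4 → Fin 4 → ℤ := fun i j =>
      if d + 2 ≤ m i + m j then ((m i + m j - d + 1).choose 3 : ℤ) else 0
    T.Finite ∧
    (T.ncard : ℤ) = ((d + 3).choose 3 : ℤ) - ∑ i, ((m i + 2).choose 3 : ℤ) +
      ∑ i, ∑ j ∈ Finset.univ.filter (fun j => i < j), c i j := by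
  intro T c
  have hT : T = ((Finset.piAntidiag Finset.univ d).filter
      (fun a : Fin 4 → ℕ => ∀ i, a i ≤ d - m i) : Finset (Fin 4 → ℕ)) := by
    ext a
    simp [T]
  refine ⟨hT ▸ Finset.finite_toSet _, ?_⟩
  rw [hT, Set.ncard_coe_finset, ← Finset.sum_boole]
  have h0 : ((d + 3).choose 3 : ℤ)
      = ∑ a ∈ Finset.piAntidiag (Finset.univ : Finset (Fin 4)) d, 1 := by
    have := aux_card d 0
    simp at this
    simp [this]
  have h1 : ∀ i, ((m i + 2).choose 3 : ℤ) = _ := fun i => (aux_single d (m i) (hm i) i).symm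
  have h2 : ∀ i, ∀ j ∈ Finset.univ.filter (fun j => i < j), c i j = _ := fun i j hj =>
    (aux_pair d (m i) (m j) (hm i) (hm j) i j (by simp at hj; exact hj.ne)).symm
  rw [h0, Finset.sum_congr rfl (fun i _ => h1 i),
    Finset.sum_congr rfl (fun i _ => Finset.sum_congr rfl (h2 i))]
  simp only [Finset.sum_comm (t := Finset.piAntidiag (Finset.univ : Finset (Fin 4)) d)]
  rw [← Finset.sum_sub_distrib, ← Finset.sum_add_distrib]
  refine Finset.sum_congr rfl fun a ha => ?_
  have hs := (Finset.mem_piAntidiag.1 ha).1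
  have f0 : Finset.univ.filter (fun j : Fin 4 => 0 < j) = {1, 2, 3} := by decide
  have f1 : Finset.univ.filter (fun j : Fin 4 => 1 < j) = {2, 3} := by decide
  have f2 : Finset.univ.filter (fun j : Fin 4 => 2 < j) = {3} := by decide
  have f3 : Finset.univ.filter (fun j : Fin 4 => 3 < j) = ∅ := by decide
  have g0 := hm 0
  have g1 := hm 1
  have g2 := hm 2
  have g3 := hm 3
  have t0 := hstd 0 1 2 (by decide) (by decide) (by decide)
  have t1 := hstd 0 1 3 (by decide) (by decide) (by decide)
  have t2 := hstd 0 2 3 (by decide) (by decide) (by decide)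
  have t3 := hstd 1 2 3 (by decide) (by decide) (by decide)
  have s0 : (∀ i, a i ≤ d - m i) ↔ (¬ d - m 0 < a 0 ∧ ¬ d - m 1 < a 1 ∧ ¬ d - m 2 < a 2
      ∧ ¬ d - m 3 < a 3) := by
    simp [Fin.forall_fin_succ]
  rw [Fin.sum_univ_four] at hs
  have e0 : ∀ f : Fin 4 → ℤ, ∑ j ∈ ({1, 2, 3} : Finset (Fin 4)), f j = f 1 + (f 2 + f 3) := by
    intro f
    rw [Finset.sum_insert (by decide), Finset.sum_insert (by decide), Finset.sum_singleton]
  have e1 : ∀ f : Fin 4 → ℤ, ∑ j ∈ ({2, 3} : Finset (Fin 4)), f j = f 2 + f 3 := by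
    intro f
    rw [Finset.sum_insert (by decide), Finset.sum_singleton]
  simp only [s0, Fin.sum_univ_four, f0, f1, f2, f3, e0, e1, Finset.sum_singleton,
    Finset.sum_empty]
  have q0 : ¬ (d - m 0 < a 0 ∧ d - m 1 < a 1 ∧ d - m 2 < a 2) := by omega
  have q1 : ¬ (d - m 0 < a 0 ∧ d - m 1 < a 1 ∧ d - m 3 < a 3) := by omega
  have q2 : ¬ (d - m 0 < a 0 ∧ d - m 2 < a 2 ∧ d - m 3 < a 3) := by omega
  have q3 : ¬ (d - m 1 < a 1 ∧ d - m 2 < a 2 ∧ d - m 3 < a 3) := by omega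
  by_cases k0 : d - m 0 < a 0 <;> by_cases k1 : d - m 1 < a 1 <;>
    by_cases k2 : d - m 2 < a 2 <;> by_cases k3 : d - m 3 < a 3 <;>
    first
    | (exfalso; omega)
    | simp [k0, k1, k2, k3]
end

section
/- Let d be a natural number and m : Fin 4 → ℕ with m i ≤ d for all i, and suppose 2d ≥ m i + m j + m k for every three distinct indices i, j, k in Fin 4. Set k₀ = 2d - Σ_i m i ∈ ℤ, and note that d' := 3d - Σ_i m i ≥ 0 and m'_i := m i + k₀ ≥ 0 for all i. Then the following identity holds in ℤ: (C(d'+3, 3) - Σ_i C(m'_i + 2, 3)) - (C(d+3, 3) - Σ_i C(m i + 2, 3)) = Σ_{i<j, t_{ij} ≥ 2} C(t_{ij} + 1, 3) - Σ_{i<j, t_{ij} ≤ -2} C(1 - t_{ij}, 3), where t_{ij} = m i + m j - d. -/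
theorem six_choose_nat (n : ℕ) : 6 * (n.choose 3 : ℤ) = (n : ℤ) * (n - 1) * (n - 2) := by
  induction n with
  | zero => simp
  | succ k ih =>
    have h2 : 2 * (k.choose 2 : ℤ) = (k : ℤ) * (k - 1) := by
      clear ih
      induction k with
      | zero => simp
      | succ l ih =>
        rw [Nat.choose_succ_succ' l 1]
        push_cast
        rw [Nat.choose_one_right]
        linarith
    rw [Nat.choose_succ_succ' k 2]
    push_cast
    linarith

theorem six_choose_int (n : ℤ) (hn : 0 ≤ n) :
    6 * (n.toNat.choose 3 : ℤ) = n * (n - 1) * (n - 2) := by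
  rw [six_choose_nat, Int.toNat_of_nonneg hn]

theorem six_t (t : ℤ) : 6 * ((if 2 ≤ t then ((t + 1).toNat.choose 3 : ℤ) else 0) -
    (if t ≤ -2 then ((1 - t).toNat.choose 3 : ℤ) else 0)) = (t + 1) * t * (t - 1) := by
  rcases le_or_gt 2 t with h | h
  · have h' : ¬ t ≤ -2 := by omega
    rw [if_pos h, if_neg h', sub_zero, six_choose_int _ (by omega)]
    ring
  · rcases le_or_gt t (-2) with h1 | h1
    · rw [if_neg (by omega), if_pos h1, zero_sub, mul_neg, six_choose_int _ (by omega)]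
      ring
    · rw [if_neg (by omega), if_neg (by omega)]
      have : t = -1 ∨ t = 0 ∨ t = 1 := by omega
      rcases this with rfl | rfl | rfl <;> norm_num

theorem virtual_dim_change (d : ℕ) (m : Fin 4 → ℕ) (hm : ∀ i, m i ≤ d)
    (hstd : ∀ i j k : Fin 4, i ≠ j → i ≠ k → j ≠ k → m i + m j + m k ≤ 2 * d) :
    let k₀ : ℤ := 2 * (d : ℤ) - ∑ i, (m i : ℤ)
    let d' : ℤ := 3 * (d : ℤ) - ∑ i, (m i : ℤ)
    let m' : Fin 4 → ℤ := fun i => (m i : ℤ) + k₀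
    let t : Fin 4 → Fin 4 → ℤ := fun i j => (m i : ℤ) + m j - d
    0 ≤ d' ∧ (∀ i, 0 ≤ m' i) ∧
    (((d' + 3).toNat.choose 3 : ℤ) - ∑ i, ((m' i + 2).toNat.choose 3 : ℤ)) -
      (((d + 3).choose 3 : ℤ) - ∑ i, ((m i + 2).choose 3 : ℤ)) =
    (∑ i, ∑ j ∈ Finset.univ.filter (fun j => i < j),
        (if 2 ≤ t i j then ((t i j + 1).toNat.choose 3 : ℤ) else 0)) -
      ∑ i, ∑ j ∈ Finset.univ.filter (fun j => i < j),
        (if t i j ≤ -2 then ((1 - t i j).toNat.choose 3 : ℤ) else 0) := by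
  intro k₀ d' m' t
  have hS : ∑ i, (m i : ℤ) = m 0 + m 1 + m 2 + m 3 := by
    simp [Fin.sum_univ_four]
  have a0 := hstd 1 2 3 (by decide) (by decide) (by decide)
  have a1 := hstd 0 2 3 (by decide) (by decide) (by decide)
  have a2 := hstd 0 1 3 (by decide) (by decide) (by decide)
  have a3 := hstd 0 1 2 (by decide) (by decide) (by decide)
  have b3 := hm 3
  have hd : 0 ≤ d' := by
    simp only [d', hS]
    omega
  have hm' : ∀ i, 0 ≤ m' i := by
    intro i
    simp only [m', k₀, hS]
    fin_cases i <;> simp <;> omega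
  refine ⟨hd, hm', ?_⟩
  have cd' := six_choose_int (d' + 3) (by omega)
  have cd := six_choose_nat (d + 3)
  have cm' := fun i => six_choose_int (m' i + 2) (by have := hm' i; omega)
  have cm := fun i => six_choose_nat (m i + 2)
  have ct := fun i j => six_t (t i j)
  rw [← Finset.sum_sub_distrib]
  simp_rw [← Finset.sum_sub_distrib]
  generalize hf : (fun i j => (if 2 ≤ t i j then ((t i j + 1).toNat.choose 3 : ℤ) else 0) -
    (if t i j ≤ -2 then ((1 - t i j).toNat.choose 3 : ℤ) else 0)) = f
  have hfe : ∀ i j, (if 2 ≤ t i j then ((t i j + 1).toNat.choose 3 : ℤ) else 0) -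
    (if t i j ≤ -2 then ((1 - t i j).toNat.choose 3 : ℤ) else 0) = f i j := by
    intro i j
    rw [← hf]
  simp_rw [hfe] at ct ⊢
  have e0 : Finset.univ.filter (fun j : Fin 4 => 0 < j) = {1, 2, 3} := by decide
  have e1 : Finset.univ.filter (fun j : Fin 4 => 1 < j) = {2, 3} := by decide
  have e2 : Finset.univ.filter (fun j : Fin 4 => 2 < j) = {3} := by decide
  have e3 : Finset.univ.filter (fun j : Fin 4 => 3 < j) = ∅ := by decide
  have hR : (∑ i, ∑ j ∈ Finset.univ.filter (fun j => i < j), f i j) =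
      f 0 1 + f 0 2 + f 0 3 + f 1 2 + f 1 3 + f 2 3 := by
    rw [Fin.sum_univ_four, e0, e1, e2, e3]
    simp
    ring
  rw [hR, Fin.sum_univ_four, Fin.sum_univ_four]
  have c0 := cm 0
  have c1 := cm 1
  have c2 := cm 2
  have c3 := cm 3
  have p0 := cm' 0
  have p1 := cm' 1
  have p2 := cm' 2
  have p3 := cm' 3
  have t1 := ct 0 1
  have t2 := ct 0 2
  have t3 := ct 0 3
  have t4 := ct 1 2
  have t5 := ct 1 3
  have t6 := ct 2 3
  refine mul_left_cancel₀ (show (6 : ℤ) ≠ 0 by norm_num) ?_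
  simp only [mul_sub, mul_add, cd', cd, c0, c1, c2, c3, p0, p1, p2, p3, t1, t2, t3, t4, t5, t6]
  simp only [d', m', k₀, t, hS]
  push_cast
  ring
end

section
/- Let d be a natural number and m : Fin 4 → ℕ with m i ≤ d for all i, suppose 2d ≥ m i + m j + m k for every three distinct indices i, j, k in Fin 4, and suppose moreover Σ_i m i > 2d (so that the Cremona transformation strictly decreases the degree). Set d' = 3d - Σ_i m i and m'_i = m i + (2d - Σ_j m j) (both nonnegative under the hypotheses). Then C(d'+3, 3) - Σ_i C(m'_i + 2, 3) ≥ C(d+3, 3) - Σ_i C(m i + 2, 3), as an inequality in ℤ; that is, the virtual dimension does not decrease. -/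
lemma choose_three_aux (n : ℕ) :
    (6 : ℤ) * ((n.choose 3 : ℕ) : ℤ) = (n : ℤ) * ((n : ℤ) - 1) * ((n : ℤ) - 2) := by
  induction n with
  | zero => simp
  | succ k ih =>
    have h2 : (2 : ℤ) * ((k.choose 2 : ℕ) : ℤ) = (k : ℤ) * ((k : ℤ) - 1) := by
      clear ih
      induction k with
      | zero => simp
      | succ l ih =>
        rw [Nat.choose_succ_succ' l 1, Nat.choose_one_right]
        push_cast
        linarith
    rw [Nat.choose_succ_succ' k 2]
    push_cast
    linarith

lemma choose_three_toNat (z : ℤ) (hz : 0 ≤ z) :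
    (6 : ℤ) * ((z.toNat.choose 3 : ℕ) : ℤ) = z * (z - 1) * (z - 2) := by
  rw [choose_three_aux, Int.toNat_of_nonneg hz]

lemma pair_aux (a b : ℤ) (h : 0 < a + b) : 0 ≤ (a ^ 3 - a) + (b ^ 3 - b) := by
  have h1 : 0 < a ^ 2 - a * b + b ^ 2 := by
    nlinarith [sq_nonneg (a - b), mul_pos h h]
  have h2 : 0 ≤ (a + b) * (a ^ 2 - a * b + b ^ 2 - 1) :=
    mul_nonneg h.le (by linarith)
  linarith

theorem virtual_dim_nondecreasing (d : ℕ) (m : Fin 4 → ℕ) (hm : ∀ i, m i ≤ d)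
    (hstd : ∀ i j k : Fin 4, i ≠ j → i ≠ k → j ≠ k → m i + m j + m k ≤ 2 * d)
    (hdeg : 2 * (d : ℤ) < ∑ i, (m i : ℤ)) :
    let d' : ℤ := 3 * (d : ℤ) - ∑ i, (m i : ℤ)
    let m' : Fin 4 → ℤ := fun i => (m i : ℤ) + (2 * (d : ℤ) - ∑ j, (m j : ℤ))
    (((d + 3).choose 3 : ℤ) - ∑ i, ((m i + 2).choose 3 : ℤ)) ≤
      ((d' + 3).toNat.choose 3 : ℤ) - ∑ i, ((m' i + 2).toNat.choose 3 : ℤ) := by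
  intro d' m'
  have a0 := hstd 1 2 3 (by decide) (by decide) (by decide)
  have a1 := hstd 0 2 3 (by decide) (by decide) (by decide)
  have a2 := hstd 0 1 3 (by decide) (by decide) (by decide)
  have a3 := hstd 0 1 2 (by decide) (by decide) (by decide)
  have b0 := hm 0
  simp only [d', m', Fin.sum_univ_four] at hdeg ⊢
  generalize m 0 = x at *
  generalize m 1 = y at *
  generalize m 2 = z at *
  generalize m 3 = w at *
  have e := choose_three_aux (d + 3)
  have e0 := choose_three_aux (x + 2)
  have e1 := choose_three_aux (y + 2)
  have e2 := choose_three_aux (z + 2)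
  have e3 := choose_three_aux (w + 2)
  have f := choose_three_toNat (3 * (d : ℤ) - (x + y + z + w) + 3) (by omega)
  have f0 := choose_three_toNat ((x : ℤ) + (2 * d - (x + y + z + w)) + 2) (by omega)
  have f1 := choose_three_toNat ((y : ℤ) + (2 * d - (x + y + z + w)) + 2) (by omega)
  have f2 := choose_three_toNat ((z : ℤ) + (2 * d - (x + y + z + w)) + 2) (by omega)
  have f3 := choose_three_toNat ((w : ℤ) + (2 * d - (x + y + z + w)) + 2) (by omega)
  have p1 := pair_aux ((x : ℤ) + y - d) (z + w - d) (by linarith)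
  have p2 := pair_aux ((x : ℤ) + z - d) (y + w - d) (by linarith)
  have p3 := pair_aux ((x : ℤ) + w - d) (y + z - d) (by linarith)
  push_cast at e e0 e1 e2 e3
  linarith
end

section
/- Let r ≥ 4, δ ∈ ℤ, μ : Fin r → ℤ, let s : Fin 4 → Fin r be injective, and set h = δ - Σ_{i : Fin 4} μ(s i), δ' = δ + 2h, and μ'(j) = μ(j) + h for j in the range of s, μ'(j) = μ(j) otherwise. Then 2δ' - Σ_j μ'(j) = 2δ - Σ_j μ(j) and δ'² - 2·Σ_j μ'(j)² + 3 = δ² - 2·Σ_j μ(j)² + 3. -/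
theorem cremona_move_invariants (r : ℕ) (hr : 4 ≤ r) (δ : ℤ) (μ : Fin r → ℤ)
    (s : Fin 4 → Fin r) (hs : Function.Injective s)
    (h : ℤ) (hh : h = δ - ∑ i, μ (s i))
    (δ' : ℤ) (hδ' : δ' = δ + 2 * h)
    (μ' : Fin r → ℤ)
    (hμ' : ∀ j, μ' j = if j ∈ Set.range s then μ j + h else μ j) :
    2 * δ' - ∑ j, μ' j = 2 * δ - ∑ j, μ j ∧
    δ' ^ 2 - 2 * ∑ j, (μ' j) ^ 2 + 3 = δ ^ 2 - 2 * ∑ j, (μ j) ^ 2 + 3 := by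
  have key : ∀ G : ℤ → ℤ, ∑ i, (G (μ (s i) + h) - G (μ (s i))) = ∑ j, (G (μ' j) - G (μ j)) := by
    intro G
    refine Fintype.sum_of_injective s hs _ _ ?_ ?_
    · intro j hj
      rw [hμ' j, if_neg hj, sub_self]
    · intro i
      rw [hμ' (s i), if_pos (Set.mem_range_self i)]
  have h1 := key (fun x => x)
  have h2 := key (fun x => x ^ 2)
  simp only [Finset.sum_sub_distrib (s := (Finset.univ : Finset (Fin r)))] at h1 h2
  simp only [Fin.sum_univ_four] at h1 h2 hh
  subst hδ'
  constructor
  · linarith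
  · linear_combination 2 * h2 - 4 * h * hh
end

section
/- Let r ≥ 4 and let p ≠ q be two indices in Fin r. Start from the line class (δ₀, μ₀) with δ₀ = 1, μ₀(p) = μ₀(q) = 1 and μ₀(j) = 0 otherwise, and apply a finite sequence of Cremona moves with injections s₁, …, s_a : Fin 4 → Fin r, producing pairs (δ₁, μ₁), …, (δ_a, μ_a), where h_j = δ_{j-1} - Σ_i μ_{j-1}(s_j i) is the parameter of the j-th move. Then for every d ∈ ℤ and every m : Fin r → ℤ one has the identity d·δ_a - Σ_j μ_a(j)·m(j) = (d - m(p) - m(q)) + Σ_{j=1}^{a} h_j·(2d - Σ_{i : Fin 4} m(s_j i)). -/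
theorem intersection_decomposition (r : ℕ) (hr : 4 ≤ r) (p q : Fin r) (hpq : p ≠ q)
    (a : ℕ) (s : ℕ → Fin 4 → Fin r) (hs : ∀ j < a, Function.Injective (s j))
    (δ : ℕ → ℤ) (μ : ℕ → Fin r → ℤ) (h : ℕ → ℤ)
    (hδ0 : δ 0 = 1) (hμ0 : ∀ k, μ 0 k = if k = p ∨ k = q then 1 else 0)
    (hh : ∀ j < a, h j = δ j - ∑ i, μ j (s j i))
    (hδstep : ∀ j < a, δ (j + 1) = δ j + 2 * h j)
    (hμstep : ∀ j < a, ∀ k,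
      μ (j + 1) k = if k ∈ Set.range (s j) then μ j k + h j else μ j k)
    (d : ℤ) (m : Fin r → ℤ) :
    d * δ a - ∑ k, μ a k * m k =
      (d - m p - m q) + ∑ j ∈ Finset.range a, h j * (2 * d - ∑ i, m (s j i)) := by
  have key : ∀ b, b ≤ a → d * δ b - ∑ k, μ b k * m k =
      (d - m p - m q) + ∑ j ∈ Finset.range b, h j * (2 * d - ∑ i, m (s j i)) := by
    intro b
    induction b with
    | zero =>
      intro _
      have e : ∀ k, μ 0 k * m k = (if k = p then m k else 0) + (if k = q then m k else 0) := by
        intro k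
        rw [hμ0]
        by_cases h1 : k = p
        · have h2 : k ≠ q := fun h2 => hpq (h1.symm.trans h2)
          simp [h1, hpq]
        · simp [h1]
      simp only [e, Finset.sum_add_distrib, Finset.sum_ite_eq', Finset.mem_univ, if_true, hδ0,
        Finset.range_zero, Finset.sum_empty]
      ring
    | succ b ih =>
      intro hb
      have hb' : b < a := hb
      have e : ∀ k, μ (b + 1) k * m k
          = μ b k * m k + h b * (∑ i, if k = s b i then m k else 0) := by
        intro k
        rw [hμstep b hb']
        split_ifs with hk
        · obtain ⟨i, rfl⟩ := hk
          simp only [(hs b hb').eq_iff, Finset.sum_ite_eq, Finset.mem_univ, if_true]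
          ring
        · have : ∀ i, k ≠ s b i := fun i hi => hk ⟨i, hi.symm⟩
          simp [this]
      rw [Finset.sum_range_succ, ← add_assoc, ← ih hb'.le, hδstep b hb']
      simp only [e, Finset.sum_add_distrib, ← Finset.mul_sum]
      rw [Finset.sum_comm]
      simp only [Finset.sum_ite_eq', Finset.mem_univ, if_true]
      ring
  exact key a le_rfl
end

section
/- Let r ≥ 4 and let p ≠ q be two indices in Fin r. Let (δ_a, μ_a) be obtained from the line class (δ₀ = 1, μ₀ = indicator of {p, q}) by a finite sequence of Cremona moves with injections s₁, …, s_a, each of which is degree-increasing, i.e. h_j = δ_{j-1} - Σ_i μ_{j-1}(s_j i) ≥ 1 for every j. Let d ∈ ℤ and m : Fin r → ℤ satisfy: 2d ≥ Σ_{i : Fin 4} m(s i) for every injective s : Fin 4 → Fin r, and d ≥ m(p) + m(q). Then d·δ_a - Σ_j μ_a(j)·m(j) ≥ 0. -/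
theorem standard_form_nonneg_intersection (r : ℕ) (hr : 4 ≤ r)
    (p q : Fin r) (hpq : p ≠ q)
    (a : ℕ) (s : ℕ → Fin 4 → Fin r) (hs : ∀ j < a, Function.Injective (s j))
    (δ : ℕ → ℤ) (μ : ℕ → Fin r → ℤ) (h : ℕ → ℤ)
    (hδ0 : δ 0 = 1) (hμ0 : ∀ k, μ 0 k = if k = p ∨ k = q then 1 else 0)
    (hh : ∀ j < a, h j = δ j - ∑ i, μ j (s j i))
    (hδstep : ∀ j < a, δ (j + 1) = δ j + 2 * h j)
    (hμstep : ∀ j < a, ∀ k,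
      μ (j + 1) k = if k ∈ Set.range (s j) then μ j k + h j else μ j k)
    (hinc : ∀ j < a, 1 ≤ h j)
    (d : ℤ) (m : Fin r → ℤ)
    (hstd : ∀ s' : Fin 4 → Fin r, Function.Injective s' → ∑ i, m (s' i) ≤ 2 * d)
    (hline : m p + m q ≤ d) :
    0 ≤ d * δ a - ∑ k, μ a k * m k := by
  have key : ∀ n, n ≤ a → 0 ≤ d * δ n - ∑ k, μ n k * m k := by
    intro n
    induction n with
    | zero =>
      intro _
      have e : ∑ k, μ 0 k * m k = m p + m q := by
        have e1 : ∀ k, μ 0 k * m k = (if k = p then m k else 0) + (if k = q then m k else 0) := by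
          intro k
          rw [hμ0]
          by_cases h1 : k = p
          · subst h1
            simp [hpq]
          · simp [h1]
        simp only [e1, Finset.sum_add_distrib, Finset.sum_ite_eq', Finset.mem_univ, if_true]
      rw [e, hδ0]
      linarith
    | succ n ih =>
      intro hn
      have hn' : n < a := hn
      have ih' := ih hn'.le
      have e : ∑ k, μ (n + 1) k * m k = ∑ k, μ n k * m k + h n * ∑ i, m (s n i) := by
        have e1 : ∀ k, μ (n + 1) k * m k
            = μ n k * m k + h n * (if k ∈ Finset.univ.image (s n) then m k else 0) := by
          intro k
          rw [hμstep n hn' k]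
          by_cases hk : k ∈ Set.range (s n)
          · have hk2 : k ∈ Finset.univ.image (s n) := by simpa using hk
            rw [if_pos hk, if_pos hk2]
            ring
          · have hk2 : k ∉ Finset.univ.image (s n) := by simpa using hk
            rw [if_neg hk, if_neg hk2]
            ring
        simp only [e1, Finset.sum_add_distrib, ← Finset.mul_sum]
        rw [Finset.sum_ite_mem, Finset.univ_inter,
          Finset.sum_image (fun x _ y _ hxy => hs n hn' hxy)]
      rw [e, hδstep n hn']
      have h1 := hstd (s n) (hs n hn')
      have h2 := hinc n hn'
      have h3 : 0 ≤ h n * (2 * d - ∑ i, m (s n i)) :=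
        mul_nonneg (by linarith) (by linarith)
      linarith
  exact key a le_rfl
end

section
/- Let r ≥ 8 and let p ≠ q be two indices in Fin r. There is no finite sequence of Cremona moves transforming the line class (δ = 1, μ = indicator of {p, q}) into the quartic class (δ = 4, μ(j) = 1 for eight distinct indices j and μ(j) = 0 for all the others). -/
theorem sum_range_aux {r n : ℕ} (s : Fin n → Fin r) (hs : Function.Injective s) (f : Fin r → ℤ)
    [DecidablePred (· ∈ Set.range s)] :
    ∑ k, (if k ∈ Set.range s then f k else 0) = ∑ i, f (s i) := by
  classical
  rw [← Finset.sum_filter, ← Finset.sum_image (f := f) (s := Finset.univ) (g := s) hs.injOn]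
  apply Finset.sum_congr _ (fun _ _ => rfl)
  ext k
  simp

theorem quartic_not_image_of_line (r : ℕ) (hr : 8 ≤ r)
    (p q : Fin r) (hpq : p ≠ q) (e : Fin 8 → Fin r) (he : Function.Injective e) :
    ¬ ∃ (a : ℕ) (s : ℕ → Fin 4 → Fin r) (δ : ℕ → ℤ) (μ : ℕ → Fin r → ℤ),
      (∀ j < a, Function.Injective (s j)) ∧
      δ 0 = 1 ∧ (∀ k, μ 0 k = if k = p ∨ k = q then 1 else 0) ∧
      (∀ j < a, δ (j + 1) = δ j + 2 * (δ j - ∑ i, μ j (s j i))) ∧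
      (∀ j < a, ∀ k, μ (j + 1) k =
        if k ∈ Set.range (s j) then μ j k + (δ j - ∑ i, μ j (s j i)) else μ j k) ∧
      δ a = 4 ∧ (∀ k, μ a k = if k ∈ Set.range e then 1 else 0) := by
  rintro ⟨a, s, δ, μ, hs, hδ0, hμ0, hδ, hμ, hδa, hμa⟩
  have inv : ∀ j ≤ a, (δ j) ^ 2 - 2 * ∑ k, (μ j k) ^ 2 = -3 := by
    intro j
    induction j with
    | zero =>
      intro _
      have h : ∑ k, (μ 0 k) ^ 2 = ∑ k, ((if k = p then 1 else 0) + (if k = q then 1 else 0) : ℤ) := by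
        apply Finset.sum_congr rfl
        intro k _
        rw [hμ0]
        by_cases h1 : k = p
        · subst h1
          simp [hpq]
        · by_cases h2 : k = q <;> simp [h1, h2, hpq.symm]
      rw [h, Finset.sum_add_distrib, hδ0]
      simp
    | succ j ih =>
      intro hj
      have hj' : j < a := hj
      have ih := ih hj'.le
      obtain ⟨h, hh⟩ : ∃ h, h = δ j - ∑ i, μ j (s j i) := ⟨_, rfl⟩
      have key : ∑ k, (μ (j+1) k) ^ 2 = ∑ k, (μ j k) ^ 2 + ∑ i, (2 * h * μ j (s j i) + h ^ 2) := by
        rw [← sum_range_aux (s j) (hs j hj') (fun k => 2 * h * μ j k + h ^ 2),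
          ← Finset.sum_add_distrib]
        apply Finset.sum_congr rfl
        intro k _
        rw [hμ j hj' k, ← hh]
        split_ifs <;> ring
      rw [key, hδ j hj', ← hh, Finset.sum_add_distrib, ← Finset.mul_sum]
      have h3 : ∑ i, μ j (s j i) = δ j - h := by rw [hh]; ring
      rw [h3]
      simp only [Finset.sum_const, Finset.card_univ, Fintype.card_fin, nsmul_eq_mul]
      push_cast
      linear_combination ih
  have h1 := inv a le_rfl
  have h2 : ∑ k, (μ a k) ^ 2 = 8 := by
    rw [← Finset.sum_congr rfl (fun k _ => ?_)]
    · exact sum_range_aux e he (fun _ => 1) |>.trans (by simp)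
    · rw [hμa]
      split_ifs <;> simp
  rw [h2, hδa] at h1
  norm_num at h1
end
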